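/- Let β be the uniform Bernoulli measure on B^ℕ giving each of the four letters of B probability 1/4 independently in each coordinate. Then for β-almost every ω ∈ B^ℕ, the potential φ(ω) is well defined as a limit: the real sequence log( W(ω_1⋯ω_n)/W(ω_2⋯ω_n) ) converges as n → ∞ (its limsup and liminf coincide). -/

import Mathlib

open MeasureTheory

/-- The four matrices `A_b` indexed by `B = {(0,0),(1,0),(0,1),(1,1)}`
(encoded as `Bool × Bool`, `false ↦ 0`, `true ↦ 1`), with real entries. -/
def Amat : Bool × Bool → Matrix (Fin 4) (Fin 4) ℝ
  | (false, false) => !![3,1,1,1; 0,1,0,0; 0,0,1,0; 0,0,0,1]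
  | (true, false)  => !![1,0,1,0; 1,3,0,1; 0,0,0,0; 0,0,1,1]
  | (false, true)  => !![1,1,0,0; 0,0,0,0; 1,0,3,1; 0,1,0,1]
  | (true, true)   => !![1,0,0,0; 0,1,0,0; 0,0,1,0; 1,1,1,3]

/-- `W(ω_1⋯ω_n) = (1,1,1,1) · A_{ω_1}⋯A_{ω_n} · (1,0,0,0)ᵀ` for the length-`n`
prefix of the sequence `ω`. -/
def Wpre (ω : ℕ → Bool × Bool) (n : ℕ) : ℝ :=
  ∑ i : Fin 4, ((List.ofFn fun k : Fin n => Amat (ω k)).prod) i 0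

open scoped Matrix in
/-- A nonnegative matrix preserves entrywise domination of row vectors. -/
lemma vecMul_apply_le {ι : Type*} [Fintype ι] {M : Matrix ι ι ℝ} (hM : ∀ i j, 0 ≤ M i j)
    {p s : ι → ℝ} {h : ℝ} (hp : ∀ i, p i ≤ h * s i) (j : ι) :
    (p ᵥ* M) j ≤ h * (s ᵥ* M) j := by
  simp only [Matrix.vecMul, dotProduct, Finset.mul_sum]
  refine Finset.sum_le_sum fun i _ => ?_
  nlinarith [mul_le_mul_of_nonneg_right (hp i) (hM i j)]

open scoped Matrix in
/-- If every row of `M` either vanishes or has entries in `[1, C]`, then `M` moves an upper bound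
for the ratios `p i / s i` towards their mean over the nonzero rows. -/
lemma vecMul_apply_le_of_rows {ι : Type*} [Fintype ι] [DecidableEq ι] {M : Matrix ι ι ℝ}
    {R : Finset ι} (hR : R.Nonempty) {C : ℝ} (hC : 0 < C) (h0 : ∀ i ∉ R, ∀ j, M i j = 0)
    (h1 : ∀ i ∈ R, ∀ j, 1 ≤ M i j) (h2 : ∀ i ∈ R, ∀ j, M i j ≤ C)
    {p s : ι → ℝ} (hs : ∀ i, 0 < s i) {h : ℝ} (hp : ∀ i, p i ≤ h * s i) (j : ι) :
    (p ᵥ* M) j ≤ (h - (h - (∑ i ∈ R, p i) / ∑ i ∈ R, s i) / C) * (s ᵥ* M) j := by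
  have key : ∀ v : ι → ℝ, (v ᵥ* M) j = ∑ i ∈ R, v i * M i j := fun v => by
    rw [Matrix.vecMul, dotProduct]
    refine (Finset.sum_subset (Finset.subset_univ R) fun i _ hi => ?_).symm
    rw [h0 i hi, mul_zero]
  rw [key, key]
  have hT : 0 < ∑ i ∈ R, s i := Finset.sum_pos (fun i _ => hs i) hR
  set T := ∑ i ∈ R, s i with hTdef
  set Q := ∑ i ∈ R, p i with hQdef
  have hST : ∑ i ∈ R, s i * M i j ≤ C * T := by
    rw [hTdef, Finset.mul_sum]
    refine Finset.sum_le_sum fun i hi => ?_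
    nlinarith [mul_le_mul_of_nonneg_left (h2 i hi j) (hs i).le]
  have hgap : h * T - Q ≤ h * ∑ i ∈ R, s i * M i j - ∑ i ∈ R, p i * M i j := by
    rw [hTdef, hQdef, Finset.mul_sum, Finset.mul_sum, ← Finset.sum_sub_distrib,
      ← Finset.sum_sub_distrib]
    refine Finset.sum_le_sum fun i hi => ?_
    nlinarith [mul_le_mul_of_nonneg_left (h1 i hi j) (sub_nonneg.2 (hp i))]
  have hQ : Q ≤ h * T := by
    rw [hTdef, hQdef, Finset.mul_sum]
    exact Finset.sum_le_sum fun i _ => hp i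
  have hd : 0 ≤ (h - Q / T) / C :=
    div_nonneg (sub_nonneg.2 ((div_le_iff₀ hT).2 hQ)) hC.le
  have hmul : (h - Q / T) / C * ∑ i ∈ R, s i * M i j ≤ h * T - Q := by
    refine (mul_le_mul_of_nonneg_left hST hd).trans_eq ?_
    field_simp
  linarith

open Filter Topology in
/-- An antitone nonnegative sequence that infinitely often shrinks by a fixed factor tends to
zero. -/
lemma tendsto_zero_of_frequently_contract {D : ℕ → ℝ} (hD : Antitone D) (h0 : ∀ n, 0 ≤ D n)
    {c : ℝ} (hc : c < 1) {m : ℕ} (hf : ∃ᶠ n in atTop, D (n + m) ≤ c * D n) :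
    Tendsto D atTop (𝓝 0) := by
  have hb : BddBelow (Set.range D) := ⟨0, by rintro _ ⟨n, rfl⟩; exact h0 n⟩
  have hlim := tendsto_atTop_ciInf hD hb
  have hd : 0 ≤ ⨅ n, D n := le_ciInf h0
  have hle : (⨅ n, D n) ≤ c * ⨅ n, D n :=
    ge_of_tendsto_of_frequently (hlim.const_mul c) (hf.mono fun n hn => (ciInf_le hb _).trans hn)
  have : (⨅ n, D n) = 0 := by nlinarith
  rwa [this] at hlim

open Filter Topology in
open scoped Matrix in
/-- Ratios of the coordinates of two row vectors evolving under the same nonnegative matrices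
converge, provided a fixed block of matrices whose rows are either zero or positive occurs
infinitely often. -/
lemma exists_tendsto_ratio {ι : Type*} [Fintype ι] [DecidableEq ι] [Nonempty ι]
    {A : ℕ → Matrix ι ι ℝ} (hA : ∀ n i j, 0 ≤ A n i j) {p s : ℕ → ι → ℝ}
    (hp : ∀ n, p (n + 1) = p n ᵥ* A n) (hs : ∀ n, s (n + 1) = s n ᵥ* A n)
    (hpos : ∀ n i, 0 < s n i) {M : Matrix ι ι ℝ}
    {R : Finset ι} (hR : R.Nonempty) {C : ℝ} (hC : 0 < C) (h0 : ∀ i ∉ R, ∀ j, M i j = 0)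
    (h1 : ∀ i ∈ R, ∀ j, 1 ≤ M i j) (h2 : ∀ i ∈ R, ∀ j, M i j ≤ C)
    (hM : ∃ᶠ n in atTop, A n * A (n + 1) * A (n + 2) = M) (j : ι) :
    ∃ L, Tendsto (fun n => p n j / s n j) atTop (𝓝 L) := by
  set f : ℕ → ι → ℝ := fun n i => p n i / s n i with hfdef
  set hi : ℕ → ℝ := fun n => ⨆ i, f n i
  set lo : ℕ → ℝ := fun n => ⨅ i, f n i
  have fle : ∀ n i, f n i ≤ hi n := fun n i => le_ciSup (Set.finite_range (f n)).bddAbove i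
  have lef : ∀ n i, lo n ≤ f n i := fun n i => ciInf_le (Set.finite_range (f n)).bddBelow i
  have ple : ∀ n i, p n i ≤ hi n * s n i := fun n i => (div_le_iff₀ (hpos n i)).1 (fle n i)
  have lep : ∀ n i, (-p n) i ≤ (-lo n) * s n i := fun n i => by
    have := (le_div_iff₀ (hpos n i)).1 (lef n i)
    simp only [Pi.neg_apply]
    linarith
  have hanti : Antitone hi := antitone_nat_of_succ_le fun n => ciSup_le fun i => by
    rw [hfdef, div_le_iff₀ (hpos _ _), hp, hs]
    exact vecMul_apply_le (hA n) (ple n) i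
  have hmono : Monotone lo := monotone_nat_of_le_succ fun n => le_ciInf fun i => by
    rw [hfdef, le_div_iff₀ (hpos _ _), hp, hs]
    have := vecMul_apply_le (hA n) (lep n) i
    rw [Matrix.neg_vecMul, Pi.neg_apply] at this
    linarith
  have lehi : ∀ n, lo n ≤ hi n := fun n => (lef n j).trans (fle n j)
  have hcontract : ∃ᶠ n in atTop, (hi (n + 3) - lo (n + 3)) ≤ (1 - 1 / C) * (hi n - lo n) := by
    refine hM.mono fun n hn => ?_
    have hp3 : p (n + 3) = p n ᵥ* M := by
      rw [hp (n + 2), hp (n + 1), hp n, Matrix.vecMul_vecMul, Matrix.vecMul_vecMul, ← Matrix.mul_assoc,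
        hn]
    have hs3 : s (n + 3) = s n ᵥ* M := by
      rw [hs (n + 2), hs (n + 1), hs n, Matrix.vecMul_vecMul, Matrix.vecMul_vecMul, ← Matrix.mul_assoc,
        hn]
    set q := (∑ i ∈ R, p n i) / ∑ i ∈ R, s n i with hq
    have hup : hi (n + 3) ≤ hi n - (hi n - q) / C := ciSup_le fun i => by
      rw [hfdef, div_le_iff₀ (hpos _ _), hp3, hs3]
      exact vecMul_apply_le_of_rows hR hC h0 h1 h2 (hpos n) (ple n) i
    have hdown : lo n + (q - lo n) / C ≤ lo (n + 3) := le_ciInf fun i => by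
      rw [hfdef, le_div_iff₀ (hpos _ _), hp3, hs3]
      have := vecMul_apply_le_of_rows hR hC h0 h1 h2 (hpos n) (lep n) i
      simp only [Matrix.neg_vecMul, Pi.neg_apply, Finset.sum_neg_distrib, neg_div, ← hq] at this
      linear_combination this
    linear_combination hup + hdown
  have hD := tendsto_zero_of_frequently_contract (D := fun n => hi n - lo n)
    (fun m n hmn => sub_le_sub (hanti hmn) (hmono hmn)) (fun n => sub_nonneg.2 (lehi n))
    (sub_lt_self 1 (one_div_pos.2 hC)) hcontract
  have hb : BddBelow (Set.range hi) :=
    ⟨lo 0, by rintro _ ⟨n, rfl⟩; exact (hmono (Nat.zero_le n)).trans (lehi n)⟩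
  have hlim := tendsto_atTop_ciInf hanti hb
  refine ⟨⨅ n, hi n, tendsto_of_tendsto_of_tendsto_of_le_of_le (g := lo) ?_ hlim
    (fun n => lef n j) (fun n => fle n j)⟩
  simpa using hlim.sub hD

/-- Under the uniform cylinder measure, a block of three letters occurring after position `n` is
independent of the first `n` letters. -/
lemma measure_inter_block (β : Measure (ℕ → Bool × Bool))
    (hcyl : ∀ (n : ℕ) (z : Fin n → Bool × Bool),
      β {ω | ∀ i : Fin n, ω (i : ℕ) = z i} = (1 / 4 : ENNReal) ^ n)
    (n : ℕ) (T : Finset (Fin n → Bool × Bool)) (a b c : Bool × Bool) :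
    β ({ω | (fun i : Fin n => ω i) ∈ T} ∩ {ω | ω n = a ∧ ω (n + 1) = b ∧ ω (n + 2) = c}) =
      (1 / 4) ^ 3 * β {ω | (fun i : Fin n => ω i) ∈ T} := by
  have hT : {ω : ℕ → Bool × Bool | (fun i : Fin n => ω i) ∈ T} =
      ⋃ z ∈ T, {ω | ∀ i : Fin n, ω (i : ℕ) = z i} := by
    ext ω
    simp only [Set.mem_ofPred_eq, Set.mem_iUnion, exists_prop]
    exact ⟨fun h => ⟨_, h, fun _ => rfl⟩, fun ⟨z, hz, h⟩ => by rwa [funext h]⟩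
  have hmeas : ∀ (k : ℕ) (e : Bool × Bool), MeasurableSet {ω : ℕ → Bool × Bool | ω k = e} :=
    fun k e => measurableSet_eq_fun (measurable_pi_apply k) measurable_const
  have hcm : ∀ z : Fin n → Bool × Bool,
      MeasurableSet {ω : ℕ → Bool × Bool | ∀ i : Fin n, ω (i : ℕ) = z i} := fun z => by
    rw [Set.ofPred_forall]
    exact MeasurableSet.iInter fun i => hmeas _ _
  have hbm : MeasurableSet
      {ω : ℕ → Bool × Bool | ω n = a ∧ ω (n + 1) = b ∧ ω (n + 2) = c} :=
    (hmeas _ _).inter ((hmeas _ _).inter (hmeas _ _))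
  have hdisj : ∀ z z' : Fin n → Bool × Bool, z ≠ z' →
      Disjoint {ω : ℕ → Bool × Bool | ∀ i : Fin n, ω (i : ℕ) = z i}
        {ω | ∀ i : Fin n, ω (i : ℕ) = z' i} := fun z z' hne =>
    Set.disjoint_left.2 fun ω h h' => hne (funext fun i => (h i).symm.trans (h' i))
  rw [hT, Set.iUnion₂_inter, measure_biUnion_finset
      (fun z _ z' _ hne => (hdisj z z' hne).mono Set.inter_subset_left Set.inter_subset_left)
      (fun z _ => (hcm z).inter hbm),
    measure_biUnion_finset (fun z _ z' _ hne => hdisj z z' hne) (fun z _ => hcm z),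
    Finset.mul_sum]
  refine Finset.sum_congr rfl fun z _ => ?_
  have hset : {ω : ℕ → Bool × Bool | ∀ i : Fin n, ω (i : ℕ) = z i} ∩
      {ω | ω n = a ∧ ω (n + 1) = b ∧ ω (n + 2) = c} =
      {ω | ∀ i : Fin (n + 3), ω (i : ℕ) =
        (Fin.snoc (Fin.snoc (Fin.snoc z a : Fin (n + 1) → Bool × Bool) b :
          Fin (n + 2) → Bool × Bool) c : Fin (n + 3) → Bool × Bool) i} := by
    ext ω
    simp only [Set.mem_inter_iff, Set.mem_ofPred_eq, Fin.forall_fin_succ', Fin.snoc_castSucc,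
      Fin.snoc_last, Fin.val_castSucc, Fin.val_last, and_assoc]
  rw [hset, hcyl, hcyl, ← pow_add, add_comm]

open Filter Topology in
/-- Under the uniform cylinder measure, every block of three letters almost surely occurs
infinitely often. -/
lemma ae_frequently_block (β : Measure (ℕ → Bool × Bool)) [IsProbabilityMeasure β]
    (hcyl : ∀ (n : ℕ) (z : Fin n → Bool × Bool),
      β {ω | ∀ i : Fin n, ω (i : ℕ) = z i} = (1 / 4 : ENNReal) ^ n)
    (a b c : Bool × Bool) :
    ∀ᵐ ω ∂β, ∃ᶠ n in atTop, ω n = a ∧ ω (n + 1) = b ∧ ω (n + 2) = c := by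
  classical
  set E : ℕ → Set (ℕ → Bool × Bool) := fun n => {ω | ω n = a ∧ ω (n + 1) = b ∧ ω (n + 2) = c}
    with hE
  have hmeas : ∀ (k : ℕ) (e : Bool × Bool), MeasurableSet {ω : ℕ → Bool × Bool | ω k = e} :=
    fun k e => measurableSet_eq_fun (measurable_pi_apply k) measurable_const
  have hEm : ∀ n, MeasurableSet (E n) := fun n =>
    (hmeas _ _).inter ((hmeas _ _).inter (hmeas _ _))
  set r : ENNReal := 1 - (1 / 4) ^ 3 with hr
  have hr1 : r < 1 := ENNReal.sub_lt_self ENNReal.one_ne_top one_ne_zero (by simp)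
  have havoid : ∀ N m : ℕ, β {ω | ∀ k < m, ω ∉ E (N + 3 * k)} ≤ r ^ m := by
    intro N m
    induction m with
    | zero => simp
    | succ m ih =>
      set G : Set (ℕ → Bool × Bool) := {ω | ∀ k < m, ω ∉ E (N + 3 * k)} with hG
      set T : Finset (Fin (N + 3 * m) → Bool × Bool) :=
        Finset.univ.filter fun z => ∃ ω ∈ G, (fun i : Fin (N + 3 * m) => ω i) = z with hTdef
      have hGT : G = {ω | (fun i : Fin (N + 3 * m) => ω i) ∈ T} := by
        ext ω
        simp only [hTdef, Finset.mem_filter, Finset.mem_univ, true_and, Set.mem_ofPred_eq]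
        refine ⟨fun h => ⟨ω, h, rfl⟩, fun ⟨ω', h, heq⟩ k hk hmem => h k hk ?_⟩
        have hag : ∀ i < N + 3 * m, ω' i = ω i := fun i hi => congrFun heq ⟨i, hi⟩
        simp only [hE, Set.mem_ofPred_eq] at hmem ⊢
        rwa [hag _ (by omega), hag _ (by omega), hag _ (by omega)]
      have hinter := measure_inter_block β hcyl (N + 3 * m) T a b c
      rw [← hGT] at hinter
      have hsucc : {ω | ∀ k < m + 1, ω ∉ E (N + 3 * k)} = G \ E (N + 3 * m) := by
        ext ω
        simp only [hG, Set.mem_ofPred_eq, Set.mem_sdiff, Nat.forall_lt_succ_right]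
      rw [hsucc, ← Set.sdiff_inter_self_eq_sdiff, Set.inter_comm,
        measure_sdiff Set.inter_subset_left ?_ (measure_ne_top _ _), hinter, mul_comm, pow_succ r]
      · calc β G - β G * (1 / 4) ^ 3 = β G * r := by
              rw [hr, ENNReal.mul_sub (fun _ _ => measure_ne_top _ _), mul_one]
          _ ≤ r ^ m * r := by gcongr
      · refine (MeasurableSet.inter ?_ (hEm _)).nullMeasurableSet
        simp only [hG, Set.ofPred_forall]
        exact MeasurableSet.iInter fun k => MeasurableSet.iInter fun _ => (hEm _).compl
  rw [ae_iff]
  have hsub : {ω : ℕ → Bool × Bool | ¬ ∃ᶠ n in atTop, ω n = a ∧ ω (n + 1) = b ∧ ω (n + 2) = c} ⊆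
      ⋃ N : ℕ, {ω | ∀ k, ω ∉ E (N + 3 * k)} := by
    intro ω hω
    obtain ⟨N, hN⟩ := eventually_atTop.1 (not_frequently.1 hω)
    exact Set.mem_iUnion.2 ⟨N, fun k => hN _ (by omega)⟩
  refine measure_mono_null hsub (measure_iUnion_null fun N => ?_)
  refine le_antisymm (ge_of_tendsto' (ENNReal.tendsto_pow_atTop_nhds_zero_of_lt_one hr1)
    fun m => (measure_mono ?_).trans (havoid N m)) bot_le
  exact fun ω hω k _ => hω k

/-- The coordinate of the column-sum vector raised by the matrix of a letter. -/
def letterIndex : Bool × Bool → Fin 4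
  | (false, false) => 0
  | (true, false) => 1
  | (false, true) => 2
  | (true, true) => 3

lemma Amat_nonneg (b : Bool × Bool) (i j : Fin 4) : 0 ≤ Amat b i j := by
  rcases b with ⟨_ | _, _ | _⟩ <;> fin_cases i <;> fin_cases j <;> simp [Amat]

lemma sum_Amat (b : Bool × Bool) (j : Fin 4) :
    ∑ i, Amat b i j = 2 + if j = letterIndex b then 1 else 0 := by
  rcases b with ⟨_ | _, _ | _⟩ <;> fin_cases j <;>
    simp [Amat, letterIndex, Fin.sum_univ_four] <;> norm_num

/-- The matrix product along the length-`n` prefix of `ω`. -/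
noncomputable def prefixProd (ω : ℕ → Bool × Bool) (n : ℕ) : Matrix (Fin 4) (Fin 4) ℝ :=
  (List.ofFn fun k : Fin n => Amat (ω k)).prod

lemma prefixProd_succ (ω : ℕ → Bool × Bool) (n : ℕ) :
    prefixProd ω (n + 1) = prefixProd ω n * Amat (ω n) := by
  rw [prefixProd, List.ofFn_succ', List.concat_eq_append, List.prod_append, List.prod_singleton]
  rfl

lemma prefixProd_succ' (ω : ℕ → Bool × Bool) (n : ℕ) :
    prefixProd ω (n + 1) = Amat (ω 0) * prefixProd (fun i => ω (i + 1)) n := by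
  simp [prefixProd, List.ofFn_succ]

lemma prefixProd_nonneg (ω : ℕ → Bool × Bool) (n : ℕ) (i j : Fin 4) : 0 ≤ prefixProd ω n i j := by
  induction n generalizing j with
  | zero => simp only [prefixProd, List.ofFn_zero, List.prod_nil, Matrix.one_apply]; positivity
  | succ n ih =>
    rw [prefixProd_succ, Matrix.mul_apply]
    exact Finset.sum_nonneg fun k _ => mul_nonneg (ih k) (Amat_nonneg _ _ _)

lemma sum_prefixProd_succ (ω : ℕ → Bool × Bool) (n : ℕ) (j : Fin 4) :
    ∑ i, prefixProd ω (n + 1) i j = 2 * ∑ i, prefixProd (fun i => ω (i + 1)) n i j +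
      prefixProd (fun i => ω (i + 1)) n (letterIndex (ω 0)) j := by
  simp only [prefixProd_succ', Matrix.mul_apply]
  rw [Finset.sum_comm]
  simp only [← Finset.sum_mul, sum_Amat, add_mul, Finset.sum_add_distrib, Finset.mul_sum,
    ite_mul, one_mul, zero_mul, Finset.sum_ite_eq', Finset.mem_univ, if_true]

lemma sum_prefixProd_pos (ω : ℕ → Bool × Bool) (n : ℕ) (j : Fin 4) :
    0 < ∑ i, prefixProd ω n i j := by
  induction n generalizing ω with
  | zero => simp [prefixProd, Matrix.one_apply]
  | succ n ih =>
    rw [sum_prefixProd_succ]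
    have := ih fun i => ω (i + 1)
    have := prefixProd_nonneg (fun i => ω (i + 1)) n (letterIndex (ω 0)) j
    positivity

lemma Amat_block :
    Amat (true, true) * Amat (true, false) * Amat (false, false) =
      !![3,1,2,1; 3,4,1,2; 0,0,0,0; 6,5,6,6] := by
  ext i j
  fin_cases i <;> fin_cases j <;> simp [Amat, Matrix.mul_apply, Fin.sum_univ_four] <;> norm_num

open Filter Topology in
open scoped Matrix in
lemma exists_tendsto_prefixProd_ratio {ω : ℕ → Bool × Bool}
    (hω : ∃ᶠ n in atTop, ω n = (true, true) ∧ ω (n + 1) = (true, false) ∧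
      ω (n + 2) = (false, false)) (b j : Fin 4) :
    ∃ L, Tendsto (fun n => prefixProd ω n b j / ∑ i, prefixProd ω n i j) atTop (𝓝 L) := by
  have hone : ∀ n, (fun j => ∑ i, prefixProd ω n i j) = 1 ᵥ* prefixProd ω n := fun n => by
    ext j
    simp [Matrix.vecMul, dotProduct]
  refine exists_tendsto_ratio (A := fun n => Amat (ω n)) (fun n => Amat_nonneg _)
    (p := fun n => prefixProd ω n b) (s := fun n j => ∑ i, prefixProd ω n i j)
    (fun n => ?_) (fun n => ?_) (sum_prefixProd_pos ω)
    (M := !![3,1,2,1; 3,4,1,2; 0,0,0,0; 6,5,6,6]) (R := {0, 1, 3}) (C := 6)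
    ⟨0, by simp⟩ (by norm_num) (fun i hi j => ?_) (fun i hi j => ?_) (fun i hi j => ?_)
    (hω.mono fun n hn => ?_) j
  · simp only [prefixProd_succ]
    rfl
  · rw [hone, hone, prefixProd_succ, Matrix.vecMul_vecMul]
  · fin_cases i <;> fin_cases j <;> simp at hi ⊢
  · fin_cases i <;> fin_cases j <;> simp at hi ⊢
  · fin_cases i <;> fin_cases j <;> simp at hi ⊢ <;> norm_num
  · simp only [hn.1, hn.2.1, hn.2.2, Amat_block]

/-- for the uniform `(1/4,…,1/4)` Bernoulli measure `β` on `B^ℕ`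
(characterized by its values on cylinders), for `β`-almost every `ω` the sequence
`log( W(ω_1⋯ω_n)/W(ω_2⋯ω_n) )` converges, i.e. the potential `φ(ω)` is well
defined as a limit. -/
theorem stmt_14 (β : Measure (ℕ → Bool × Bool)) (hβ : IsProbabilityMeasure β)
    (hcyl : ∀ (n : ℕ) (z : Fin n → Bool × Bool),
      β {ω | ∀ i : Fin n, ω (i : ℕ) = z i} = (1 / 4 : ENNReal) ^ n) :
    ∀ᵐ ω ∂β, ∃ L : ℝ,
      Filter.Tendsto
        (fun n : ℕ => Real.log (Wpre ω n / Wpre (fun i => ω (i + 1)) (n - 1)))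
        Filter.atTop (nhds L) := by
  filter_upwards [ae_frequently_block β hcyl (true, true) (true, false) (false, false)] with ω hω
  have hshift : ∃ᶠ n in Filter.atTop, ω (n + 1) = (true, true) ∧ ω (n + 1 + 1) = (true, false) ∧
      ω (n + 2 + 1) = (false, false) := by
    rw [Filter.frequently_atTop] at hω ⊢
    intro N
    obtain ⟨n, hn, h⟩ := hω (N + 1)
    obtain ⟨m, rfl⟩ : ∃ m, n = m + 1 := ⟨n - 1, by omega⟩
    exact ⟨m, by omega, h⟩
  obtain ⟨L, hL⟩ := exists_tendsto_prefixProd_ratio (ω := fun i => ω (i + 1)) hshift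
    (letterIndex (ω 0)) 0
  have hL0 : 0 ≤ L := ge_of_tendsto' hL fun n =>
    div_nonneg (prefixProd_nonneg _ _ _ _) (sum_prefixProd_pos _ _ _).le
  refine ⟨Real.log (2 + L), ?_⟩
  rw [← Filter.tendsto_add_atTop_iff_nat 1]
  refine ((hL.const_add 2).log (by positivity)).congr fun n => ?_
  have hpos := sum_prefixProd_pos (fun i => ω (i + 1)) n 0
  have hW : Wpre ω (n + 1) = _ := sum_prefixProd_succ ω n 0
  have hW' : Wpre (fun i => ω (i + 1)) n = ∑ i, prefixProd (fun i => ω (i + 1)) n i 0 := rfl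
  rw [Nat.add_sub_cancel, hW, hW', add_div, mul_div_cancel_right₀ _ hpos.ne']
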